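/- For two virtual knots K and K', the following are equivalent: (i) J(K) = J(K'); (ii) K and K' are related by a finite sequence of Ξ-moves (i.e., some Gauss diagrams representing them are related by a finite sequence of Ξ-moves and Reidemeister moves). -/

import Mathlib

/-!
Combinatorial Gauss diagrams.

A Gauss diagram is encoded as a list of chord endpoints read along the
oriented circle from a basepoint.  Each endpoint records the (natural number)
label of its chord, whether it is the terminal endpoint of the (oriented)
chord, and the sign of the chord (`true` = +1, `false` = -1).
Diagrams are considered up to rotation of the basepoint and relabeling of the
chords; these renamings are included among the "Reidemeister" generators.
-/

structure Endpoint where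
  label : ℕ
  isTerminal : Bool
  sign : Bool
deriving DecidableEq

namespace Gauss

/-- The sign (±1) of the chord through an endpoint. -/
def signValue (e : Endpoint) : ℤ := if e.sign then 1 else -1

/-- The sign assigned to an endpoint: `ε` at the terminal endpoint and `-ε`
at the initial endpoint of a chord of sign `ε`. -/
def endpointValue (e : Endpoint) : ℤ := if e.isTerminal then signValue e else -signValue e

/-- The list of chord labels of the endpoints of a word. -/
def labels (L : List Endpoint) : List ℕ := L.map Endpoint.label

/-- A word is a Gauss diagram when every chord label occurring in it occurs
exactly twice, once as an initial and once as a terminal endpoint, with the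
same sign at both occurrences. -/
def IsGaussDiagram (L : List Endpoint) : Prop :=
  ∀ e ∈ L, (L.filter (fun x => x.label == e.label)).length = 2 ∧
    ∃ e' ∈ L, e'.label = e.label ∧ e'.isTerminal = !e.isTerminal ∧ e'.sign = e.sign

/-- Rotate a word so that the first endpoint satisfying `p` comes first. -/
def rotateTo (L : List Endpoint) (p : Endpoint → Bool) : List Endpoint :=
  match L.findIdx? p with
  | some i => L.drop i ++ L.take i
  | none => L

/-- The index of the chord labeled `c`: the sum of the signs assigned to the
endpoints on the arc running from the initial endpoint of the chord to its
terminal endpoint in the direction of the circle's orientation. -/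
def chordIndex (L : List Endpoint) (c : ℕ) : ℤ :=
  ((((rotateTo L (fun e => e.label == c && !e.isTerminal)).drop 1).takeWhile
      (fun e => e.label != c)).map endpointValue).sum

/-- `Jn L n`: the sum of the signs of the chords of `L` of index `n`. -/
def Jn (L : List Endpoint) (n : ℤ) : ℤ :=
  ((L.filter (fun e => e.isTerminal && decide (chordIndex L e.label = n))).map signValue).sum

/-- The odd writhe: the sum of the signs of the chords of odd index,
i.e. `J = Σ_{n odd} J_n`. -/
def oddWrithe (L : List Endpoint) : ℤ :=
  ((L.filter (fun e => e.isTerminal && decide (chordIndex L e.label % 2 ≠ 0))).map signValue).sum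

/-- Moving the basepoint of the circle. -/
def rotateStep (L L' : List Endpoint) : Prop :=
  ∃ x xs, L = x :: xs ∧ L' = xs ++ [x]

/-- Injective relabeling of the chords. -/
def relabelStep (L L' : List Endpoint) : Prop :=
  ∃ f : ℕ → ℕ, Function.Injective f ∧
    L' = L.map (fun e => Endpoint.mk (f e.label) e.isTerminal e.sign)

/-- Reidemeister move I (removal direction): remove an isolated chord whose
two endpoints are adjacent (either orientation, either sign). -/
def reid1 (L L' : List Endpoint) : Prop :=
  ∃ (A B : List Endpoint) (c : ℕ) (t s : Bool),
    c ∉ labels (A ++ B) ∧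
    L = A ++ [Endpoint.mk c t s, Endpoint.mk c (!t) s] ++ B ∧
    L' = A ++ B

/-- Reidemeister move II (removal direction): remove two chords of opposite
signs whose initial endpoints are adjacent and whose terminal endpoints are
adjacent (in either of the two admissible orders). -/
def reid2 (L L' : List Endpoint) : Prop :=
  ∃ (A B C : List Endpoint) (c d : ℕ) (s crossed : Bool),
    c ≠ d ∧ c ∉ labels (A ++ B ++ C) ∧ d ∉ labels (A ++ B ++ C) ∧
    L = A ++ [Endpoint.mk c false s, Endpoint.mk d false (!s)] ++ B ++
        (if crossed then [Endpoint.mk c true s, Endpoint.mk d true (!s)]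
         else [Endpoint.mk d true (!s), Endpoint.mk c true s]) ++ C ∧
    L' = A ++ B ++ C

/-- Reidemeister move III (a standard variant; together with the moves I, II,
rotations and relabelings it generates all versions of the third move). -/
def reid3 (L L' : List Endpoint) : Prop :=
  ∃ (A B C D : List Endpoint) (a b c : ℕ) (s : Bool),
    a ≠ b ∧ b ≠ c ∧ a ≠ c ∧
    L = A ++ [Endpoint.mk b false s, Endpoint.mk a false s] ++ B ++
        [Endpoint.mk a true s, Endpoint.mk c false (!s)] ++ C ++
        [Endpoint.mk b true s, Endpoint.mk c true (!s)] ++ D ∧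
    L' = A ++ [Endpoint.mk a false s, Endpoint.mk b false s] ++ B ++
        [Endpoint.mk c false (!s), Endpoint.mk a true s] ++ C ++
        [Endpoint.mk c true (!s), Endpoint.mk b true s] ++ D

/-- A single Reidemeister generator (including diagram renamings). -/
def reidStep (L L' : List Endpoint) : Prop :=
  rotateStep L L' ∨ relabelStep L L' ∨ reid1 L L' ∨ reid2 L L' ∨ reid3 L L'

/-- A Ξ-move: exchange the first and third of three consecutive endpoints
belonging to three distinct chords, keeping all signs and orientations. -/
def xiStep (L L' : List Endpoint) : Prop :=
  ∃ (A B : List Endpoint) (x y z : Endpoint),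
    x.label ≠ y.label ∧ y.label ≠ z.label ∧ x.label ≠ z.label ∧
    L = A ++ [x, y, z] ++ B ∧
    L' = A ++ [z, y, x] ++ B

/-- A 2k-move (removal direction): remove `2k` chords `c 0, …, c (2k-1)`, all
of sign `s`, whose `p`-endpoints appear consecutively on one arc and whose
`q`-endpoints appear consecutively on a disjoint arc, the chord `c i` being
oriented from `p` to `q` for even `i` (the paper's odd `i`, 1-indexed) and
from `q` to `p` for odd `i`, so initial and terminal endpoints alternate. -/
def move2k (k : ℕ) (L L' : List Endpoint) : Prop :=
  ∃ (A B C : List Endpoint) (c : ℕ → ℕ) (s : Bool),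
    (∀ i < 2 * k, ∀ j < 2 * k, c i = c j → i = j) ∧
    (∀ i < 2 * k, c i ∉ labels (A ++ B ++ C)) ∧
    L = A ++ (List.range (2 * k)).map (fun i => Endpoint.mk (c i) (decide (i % 2 = 1)) s)
          ++ B ++
        (List.range (2 * k)).map (fun i => Endpoint.mk (c i) (decide (i % 2 = 0)) s)
          ++ C ∧
    L' = A ++ B ++ C

/-- A crossing change: reverse the sign and the orientation of one chord. -/
def crossingChange (L L' : List Endpoint) : Prop :=
  ∃ c : ℕ,
    L' = L.map (fun e =>
      if e.label = c then Endpoint.mk e.label (!e.isTerminal) (!e.sign) else e)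

/-- Finite sequences of moves from `r`, performed in either direction. -/
def Moves (r : List Endpoint → List Endpoint → Prop) :
    List Endpoint → List Endpoint → Prop :=
  Relation.ReflTransGen (fun L L' => r L L' ∨ r L' L)

/-- Related by Reidemeister moves: the two words represent the same virtual knot. -/
def ReidEquiv : List Endpoint → List Endpoint → Prop := Moves reidStep

/-- Related by a finite sequence of 2k-moves (and Reidemeister moves). -/
def Rel2k (k : ℕ) : List Endpoint → List Endpoint → Prop :=
  Moves (fun L L' => reidStep L L' ∨ move2k k L L')

/-- Related by a finite sequence of Ξ-moves (and Reidemeister moves). -/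
def RelXi : List Endpoint → List Endpoint → Prop :=
  Moves (fun L L' => reidStep L L' ∨ xiStep L L')

/-- Related by a finite sequence of 2k-moves and Ξ-moves (and Reidemeister moves). -/
def Rel2kXi (k : ℕ) : List Endpoint → List Endpoint → Prop :=
  Moves (fun L L' => reidStep L L' ∨ move2k k L L' ∨ xiStep L L')

/-- Related by a finite sequence of crossing changes and Ξ-moves
(and Reidemeister moves). -/
def RelCCXi : List Endpoint → List Endpoint → Prop :=
  Moves (fun L L' => reidStep L L' ∨ crossingChange L L' ∨ xiStep L L')

/-- A shell-pair of sign `s`: two chords `c`, `d` of sign `s` whose four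
endpoints are consecutive, interleaved as 1st-3rd and 2nd-4th
(with arbitrary orientations `t`, `u` of the two shells). -/
def shellPair (c d : ℕ) (t u s : Bool) : List Endpoint :=
  [Endpoint.mk c t s, Endpoint.mk d u s, Endpoint.mk c (!t) s, Endpoint.mk d (!u) s]

/-- The Gauss diagram `G(a)`: `|a|` consecutive shell-pairs of sign `+1` if
`a > 0` and of sign `-1` if `a < 0`; `G(0)` has no chords.  It represents the
virtual knot `K(a)`. -/
def Gword (a : ℤ) : List Endpoint :=
  ((List.range a.natAbs).map
    (fun j => shellPair (2 * j) (2 * j + 1) false false (decide (0 < a)))).flatten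

/-- `Rel2kCount k m G G'`: `G` and `G'` are related by a finite sequence of
Reidemeister moves and exactly `m` 2k-moves. -/
inductive Rel2kCount (k : ℕ) : ℕ → List Endpoint → List Endpoint → Prop
  | refl (L : List Endpoint) : Rel2kCount k 0 L L
  | reid {m : ℕ} {L L' L'' : List Endpoint} :
      reidStep L L' ∨ reidStep L' L →
      Rel2kCount k m L' L'' → Rel2kCount k m L L''
  | move {m : ℕ} {L L' L'' : List Endpoint} :
      move2k k L L' ∨ move2k k L' L →
      Rel2kCount k m L' L'' → Rel2kCount k (m + 1) L L''

/-- The 2k-move distance: the minimal number of 2k-moves needed to relate the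
two diagrams (together with Reidemeister moves). -/
noncomputable def dist2k (k : ℕ) (L L' : List Endpoint) : ℕ :=
  sInf {m | Rel2kCount k m L L'}

end Gauss

namespace Gauss

/-! ### Basic tools -/

def fl (c : ℕ) (L : List Endpoint) : List Endpoint := L.filter (fun x => x.label == c)

/-- A perm-friendly form of being a Gauss diagram. -/
def G2 (L : List Endpoint) : Prop :=
  ∀ c, fl c L = [] ∨ ∃ s, (fl c L).Perm [Endpoint.mk c false s, Endpoint.mk c true s]

theorem fl_append (c : ℕ) (A B : List Endpoint) : fl c (A ++ B) = fl c A ++ fl c B := by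
  simp [fl]

theorem fl_cons (c : ℕ) (x : Endpoint) (B : List Endpoint) :
    fl c (x :: B) = (if x.label = c then [x] else []) ++ fl c B := by
  simp only [fl, List.filter_cons]
  by_cases h : x.label = c <;> simp [h]

theorem fl_nil (c : ℕ) : fl c [] = [] := rfl

theorem fl_eq_nil {c : ℕ} {L : List Endpoint} : fl c L = [] ↔ c ∉ labels L := by
  simp [fl, labels, List.filter_eq_nil_iff]

theorem fl_perm {c : ℕ} {L L' : List Endpoint} (h : L.Perm L') : (fl c L).Perm (fl c L') :=
  h.filter _

theorem mem_fl {c : ℕ} {L : List Endpoint} {x : Endpoint} :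
    x ∈ fl c L ↔ x ∈ L ∧ x.label = c := by
  simp [fl]

theorem mem_labels {c : ℕ} {L : List Endpoint} : c ∈ labels L ↔ ∃ x ∈ L, x.label = c := by
  simp [labels]

theorem labels_perm {L L' : List Endpoint} (h : L.Perm L') : (labels L).Perm (labels L') :=
  h.map _

theorem G2.perm {L L' : List Endpoint} (hL : G2 L) (h : L.Perm L') : G2 L' := by
  intro c
  rcases hL c with h1 | ⟨s, h1⟩
  · left
    have := fl_perm (c := c) h
    rw [h1] at this
    exact this.nil_eq.symm
  · right
    exact ⟨s, (fl_perm h).symm.trans h1⟩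

theorem perm_pair {x y a b : Endpoint} (h : [x, y].Perm [a, b]) :
    (x = a ∧ y = b) ∨ (x = b ∧ y = a) := by
  have hx : x ∈ [a, b] := h.subset (by simp)
  simp only [List.mem_cons, List.not_mem_nil, or_false] at hx
  rcases hx with rfl | rfl
  · left; simpa using h
  · right
    have := h.trans (List.Perm.swap x a [])
    simpa using this

theorem G2.pair {L R : List Endpoint} {x y : Endpoint} (hL : G2 L) (h : L.Perm (x :: y :: R))
    (hxy : x.label = y.label) :
    ∃ c t s, x = Endpoint.mk c t s ∧ y = Endpoint.mk c (!t) s ∧ c ∉ labels R := by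
  have h2 := hL.perm h
  have h3 := h2 x.label
  rw [fl_cons, fl_cons, if_pos rfl, if_pos hxy.symm] at h3
  rcases h3 with h3 | ⟨s, h3⟩
  · simp at h3
  · have hlen := h3.length_eq
    simp at hlen
    rw [hlen] at h3
    have hn := fl_eq_nil.1 hlen
    rcases perm_pair (by simpa using h3) with ⟨h4, h5⟩ | ⟨h4, h5⟩
    · exact ⟨x.label, false, s, h4, h5, hn⟩
    · exact ⟨x.label, true, s, h4, h5, hn⟩

theorem G2_iff (L : List Endpoint) : IsGaussDiagram L ↔ G2 L := by
  constructor
  · intro h c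
    by_cases hc : fl c L = []
    · exact Or.inl hc
    · right
      obtain ⟨e, he⟩ := List.exists_mem_of_ne_nil _ hc
      rw [mem_fl] at he
      obtain ⟨heL, rfl⟩ := he
      obtain ⟨h1, e', he', hl, ht, hs⟩ := h e heL
      refine ⟨e.sign, ?_⟩
      change (fl e.label L).length = 2 at h1
      have m1 : e ∈ fl e.label L := mem_fl.2 ⟨heL, rfl⟩
      have m2 : e' ∈ fl e.label L := mem_fl.2 ⟨he', hl⟩
      have hne : e ≠ e' := by
        rintro rfl
        cases hh : e.isTerminal <;> simp [hh] at ht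
      have hsub : List.Subperm [e, e'] (fl e.label L) := by
        apply List.subperm_of_subset
        · simp [hne]
        · intro z hz
          simp at hz
          rcases hz with rfl | rfl <;> assumption
      have hp : [e, e'].Perm (fl e.label L) := hsub.perm_of_length_le (by simp [h1])
      refine hp.symm.trans ?_
      obtain ⟨l, t, s⟩ := e
      obtain ⟨l', t', s'⟩ := e'
      simp only at hl ht hs
      subst hl ht hs
      cases t
      · exact List.Perm.refl _
      · exact List.Perm.swap _ _ _
  · intro h e he
    have m1 : e ∈ fl e.label L := mem_fl.2 ⟨he, rfl⟩
    rcases h e.label with h1 | ⟨s, h1⟩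
    · rw [h1] at m1; simp at m1
    · refine ⟨h1.length_eq, ?_⟩
      have m2 := h1.subset m1
      have a1 := mem_fl.1 (h1.symm.subset (List.mem_cons_self))
      have a2 := mem_fl.1 (h1.symm.subset (List.mem_cons_of_mem _ (List.mem_cons_self)))
      simp only [List.mem_cons, List.not_mem_nil, or_false] at m2
      rcases m2 with m2 | m2
      · exact ⟨_, a2.1, rfl, by rw [m2]; rfl, by rw [m2]⟩
      · exact ⟨_, a1.1, rfl, by rw [m2]; rfl, by rw [m2]⟩

theorem G2.tail {L R : List Endpoint} {c : ℕ} {t s : Bool} (hL : G2 L)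
    (h : L.Perm (Endpoint.mk c t s :: Endpoint.mk c (!t) s :: R)) : G2 R := by
  obtain ⟨c', t', s', h1, h2, h3⟩ := hL.pair h rfl
  simp only [Endpoint.mk.injEq] at h1
  obtain ⟨rfl, rfl, rfl⟩ := h1
  intro d
  by_cases hd : d = c
  · subst hd; left; exact fl_eq_nil.2 h3
  · have := (hL.perm h) d
    simpa [fl_cons, Ne.symm hd] using this

theorem G2.cons2 {R : List Endpoint} {c : ℕ} {t s : Bool} (hR : G2 R) (hc : c ∉ labels R) :
    G2 (Endpoint.mk c t s :: Endpoint.mk c (!t) s :: R) := by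
  intro d
  by_cases hd : d = c
  · subst hd
    right
    refine ⟨s, ?_⟩
    rw [fl_cons, fl_cons, fl_eq_nil.2 hc]
    simp only [if_true]
    cases t
    · exact List.Perm.refl _
    · exact List.Perm.swap _ _ _
  · have := hR d
    simpa [fl_cons, Ne.symm hd] using this

/-- extraction of a chord -/
theorem G2.extract {U : List Endpoint} (hU : G2 U) {x : Endpoint} (hx : x ∈ U) :
    ∃ U', U.Perm (Endpoint.mk x.label false x.sign :: Endpoint.mk x.label true x.sign :: U') := by
  have m1 : x ∈ fl x.label U := mem_fl.2 ⟨hx, rfl⟩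
  rcases hU x.label with h1 | ⟨s, h1⟩
  · rw [h1] at m1; simp at m1
  · have m2 := h1.subset m1
    have hs : s = x.sign := by
      simp only [List.mem_cons, List.not_mem_nil, or_false] at m2
      rcases m2 with m2 | m2 <;> rw [m2]
    subst hs
    refine ⟨_, (List.filter_append_perm (fun y => y.label == x.label) U).symm.trans
      (List.Perm.append_right _ h1)⟩

theorem G2.even {L : List Endpoint} (hL : G2 L) : Even L.length := by
  induction hn : L.length using Nat.strong_induction_on generalizing L with
  | _ n ih =>
    cases L with
    | nil => simp at hn; subst hn; simp
    | cons x L =>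
      obtain ⟨U, hU⟩ := hL.extract (List.mem_cons_self (a := x) (l := L))
      have h1 := hU.length_eq
      have h2 := hL.tail (t := false) hU
      simp only [List.length_cons] at h1 hn
      have := ih U.length (by omega) h2 rfl
      rw [← hn, h1]
      rw [Nat.even_iff] at *
      omega

/-! ### invariance of G2 under the moves -/

theorem G2_reid1 {L L' : List Endpoint} (h : reid1 L L') : G2 L ↔ G2 L' := by
  obtain ⟨A, B, c, t, s, hc, rfl, rfl⟩ := h
  have hp : (A ++ [Endpoint.mk c t s, Endpoint.mk c (!t) s] ++ B).Perm
      (Endpoint.mk c t s :: Endpoint.mk c (!t) s :: (A ++ B)) := by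
    rw [List.append_assoc]
    exact List.perm_append_comm_assoc A [_, _] B
  exact ⟨fun h => h.tail hp, fun h => (h.cons2 hc).perm hp.symm⟩

theorem reid2_perm (A B C : List Endpoint) (c d : ℕ) (s crossed : Bool) :
    (A ++ [Endpoint.mk c false s, Endpoint.mk d false (!s)] ++ B ++
        (if crossed then [Endpoint.mk c true s, Endpoint.mk d true (!s)]
         else [Endpoint.mk d true (!s), Endpoint.mk c true s]) ++ C).Perm
    (Endpoint.mk c false s :: Endpoint.mk c true s :: Endpoint.mk d false (!s) ::
      Endpoint.mk d true (!s) :: (A ++ B ++ C)) := by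
  rw [List.perm_iff_count]
  intro a
  cases crossed <;> simp [List.count_cons] <;> omega

theorem G2_reid2 {L L' : List Endpoint} (h : reid2 L L') : G2 L ↔ G2 L' := by
  obtain ⟨A, B, C, c, d, s, cr, hcd, hc, hd, rfl, rfl⟩ := h
  have hp := reid2_perm A B C c d s cr
  constructor
  · intro h
    have h1 := h.tail (t := false) hp
    exact h1.tail (t := false) (List.Perm.refl _)
  · intro h
    refine G2.perm ?_ hp.symm
    refine G2.cons2 (t := false) (G2.cons2 (t := false) h hd) ?_
    simp only [labels, List.map_cons, List.mem_cons, not_or] at hc ⊢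
    exact ⟨hcd, hcd, hc⟩

theorem G2_relabel {L L' : List Endpoint} (h : relabelStep L L') : G2 L ↔ G2 L' := by
  obtain ⟨f, hf, rfl⟩ := h
  set g : Endpoint → Endpoint := fun e => Endpoint.mk (f e.label) e.isTerminal e.sign with hg
  have hgi : Function.Injective g := by
    rintro ⟨a, b, c⟩ ⟨a', b', c'⟩ h
    simp only [hg, Endpoint.mk.injEq] at h
    rw [hf h.1, h.2.1, h.2.2]
  have key : ∀ c, fl (f c) (L.map g) = (fl c L).map g := by
    intro c
    simp only [fl, List.filter_map]
    congr 1
    apply List.filter_congr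
    intro x _
    simp [hg, hf.eq_iff]
  have hpair : ∀ c s, [Endpoint.mk (f c) false s, Endpoint.mk (f c) true s] =
      [Endpoint.mk c false s, Endpoint.mk c true s].map g := by
    intro c s; rfl
  constructor
  · intro h c
    by_cases hc : ∃ d, f d = c
    · obtain ⟨d, rfl⟩ := hc
      rw [key]
      rcases h d with h1 | ⟨s, h1⟩
      · left; simp [h1]
      · right; exact ⟨s, h1.map g⟩
    · left
      rw [fl_eq_nil, mem_labels]
      rintro ⟨x, hx, rfl⟩
      obtain ⟨y, _, rfl⟩ := List.mem_map.1 hx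
      exact hc ⟨_, rfl⟩
  · intro h c
    have := h (f c)
    rw [key] at this
    rcases this with h1 | ⟨s, h1⟩
    · left; simpa using h1
    · right
      refine ⟨s, ?_⟩
      rw [hpair] at h1
      exact (List.map_perm_map_iff hgi).1 h1

theorem rotate_perm {L L' : List Endpoint} (h : rotateStep L L') : L.Perm L' := by
  obtain ⟨x, xs, rfl, rfl⟩ := h
  exact (List.perm_append_singleton x xs).symm

theorem xi_perm {L L' : List Endpoint} (h : xiStep L L') : L.Perm L' := by
  obtain ⟨A, B, x, y, z, _, _, _, rfl, rfl⟩ := h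
  rw [List.perm_iff_count]
  intro a
  simp [List.count_cons] ; omega

theorem reid3_perm {L L' : List Endpoint} (h : reid3 L L') : L.Perm L' := by
  obtain ⟨A, B, C, D, a, b, c, s, _, _, _, rfl, rfl⟩ := h
  rw [List.perm_iff_count]
  intro a
  simp [List.count_cons] ; omega

theorem perm_G2_iff {L L' : List Endpoint} (h : L.Perm L') : G2 L ↔ G2 L' :=
  ⟨fun h1 => h1.perm h, fun h1 => h1.perm h.symm⟩

theorem G2_step {L L' : List Endpoint} (h : reidStep L L' ∨ xiStep L L') : G2 L ↔ G2 L' := by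
  rcases h with (h | h | h | h | h) | h
  · exact perm_G2_iff (rotate_perm h)
  · exact G2_relabel h
  · exact G2_reid1 h
  · exact G2_reid2 h
  · exact perm_G2_iff (reid3_perm h)
  · exact perm_G2_iff (xi_perm h)

theorem RelXi.G2_iff {L L' : List Endpoint} (h : RelXi L L') : G2 L ↔ G2 L' := by
  induction h with
  | refl => rfl
  | tail _ h ih =>
    rw [ih]
    rcases h with h | h
    · exact G2_step h
    · exact (G2_step h).symm

theorem RelXi.symm {L L' : List Endpoint} (h : RelXi L L') : RelXi L' L := by
  induction h with
  | refl => exact Relation.ReflTransGen.refl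
  | tail _ h ih => exact Relation.ReflTransGen.head h.symm ih

theorem RelXi.trans {L L' L'' : List Endpoint} (h : RelXi L L') (h' : RelXi L' L'') :
    RelXi L L'' := Relation.ReflTransGen.trans h h'

theorem RelXi.refl (L : List Endpoint) : RelXi L L := Relation.ReflTransGen.refl

theorem RelXi.ofReid {L L' : List Endpoint} (h : reidStep L L') : RelXi L L' :=
  Relation.ReflTransGen.single (Or.inl (Or.inl h))

theorem RelXi.ofXi {L L' : List Endpoint} (h : xiStep L L') : RelXi L L' :=
  Relation.ReflTransGen.single (Or.inl (Or.inr h))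

theorem RelXi.rot (A B : List Endpoint) : RelXi (A ++ B) (B ++ A) := by
  induction A generalizing B with
  | nil => simpa using RelXi.refl B
  | cons x A ih =>
    refine RelXi.trans (RelXi.ofReid (Or.inl ⟨x, A ++ B, rfl, rfl⟩)) ?_
    have := ih (B ++ [x])
    simpa using this

end Gauss

namespace Gauss

/-! ### Parity and the odd writhe -/

/-- alternating count of the occurrences of a label -/
def alt (c : ℕ) : List Endpoint → ℤ
  | [] => 0
  | x :: xs => (if x.label = c then 1 else 0) - alt c xs

theorem alt_append (c : ℕ) (A B : List Endpoint) :
    alt c (A ++ B) = alt c A + (-1) ^ A.length * alt c B := by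
  induction A with
  | nil => simp [alt]
  | cons x A ih => simp only [List.cons_append, alt, ih, List.length_cons, pow_succ]; ring

theorem alt_eq_zero {c : ℕ} {A : List Endpoint} (h : c ∉ labels A) : alt c A = 0 := by
  induction A with
  | nil => rfl
  | cons x A ih =>
    simp only [labels, List.map_cons, List.mem_cons, not_or] at h
    rw [alt, ih h.2, if_neg (Ne.symm h.1)]; rfl

open Classical in
noncomputable def term (L : List Endpoint) (e : Endpoint) : ℤ :=
  if e.isTerminal = true ∧ alt e.label L ≠ 0 then signValue e else 0

noncomputable def J2 (L : List Endpoint) : ℤ := (L.map (term L)).sum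

theorem J2_perm {L L' : List Endpoint} (h : L.Perm L')
    (ha : ∀ e ∈ L, (alt e.label L ≠ 0 ↔ alt e.label L' ≠ 0)) : J2 L = J2 L' := by
  unfold J2
  rw [← (h.map (term L')).sum_eq]
  congr 1
  apply List.map_congr_left
  intro e he
  simp only [term, ha e he]

theorem J2_rotate {L L' : List Endpoint} (hL : G2 L) (h : rotateStep L L') : J2 L = J2 L' := by
  refine J2_perm (rotate_perm h) ?_
  obtain ⟨x, xs, rfl, rfl⟩ := h
  intro e _
  have h1 := hL.even
  simp only [List.length_cons] at h1
  have h2 : Odd xs.length := by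
    rw [Nat.odd_iff]; rw [Nat.even_iff] at h1; omega
  rw [alt_append, h2.neg_one_pow]
  simp only [alt]
  constructor <;> intro h h' <;> apply h <;> linarith

theorem J2_xi {L L' : List Endpoint} (h : xiStep L L') : J2 L = J2 L' := by
  refine J2_perm (xi_perm h) ?_
  obtain ⟨A, B, x, y, z, _, _, _, rfl, rfl⟩ := h
  intro e _
  have : alt e.label (A ++ [x, y, z] ++ B) = alt e.label (A ++ [z, y, x] ++ B) := by
    simp only [alt_append, alt, List.length_append, List.length_cons, List.length_nil]
    ring
  rw [this]

theorem J2_reid3 {L L' : List Endpoint} (hL : G2 L) (h : reid3 L L') : J2 L = J2 L' := by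
  refine J2_perm (reid3_perm h) ?_
  obtain ⟨A, B, C, D, a, b, c, s, hab, hbc, hac, rfl, rfl⟩ := h
  have pa : (A ++ [Endpoint.mk b false s, Endpoint.mk a false s] ++ B ++
        [Endpoint.mk a true s, Endpoint.mk c false (!s)] ++ C ++
        [Endpoint.mk b true s, Endpoint.mk c true (!s)] ++ D).Perm
      (Endpoint.mk a false s :: Endpoint.mk a true s :: (Endpoint.mk b false s ::
        Endpoint.mk b true s :: Endpoint.mk c false (!s) :: Endpoint.mk c true (!s) ::
        (A ++ B ++ C ++ D))) := by
    rw [List.perm_iff_count]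
    intro a
    simp [List.count_cons] ; omega
  have ga := hL.tail (t := false) pa
  have gb := ga.tail (t := false) (List.Perm.refl _)
  obtain ⟨_, _, _, e1, -, na⟩ := hL.pair pa rfl
  obtain ⟨_, _, _, e2, -, nb⟩ := ga.pair (List.Perm.refl _) rfl
  obtain ⟨_, _, _, e3, -, nc⟩ := gb.pair (List.Perm.refl _) rfl
  simp only [Endpoint.mk.injEq] at e1 e2 e3
  obtain ⟨rfl, -, -⟩ := e1
  obtain ⟨rfl, -, -⟩ := e2
  obtain ⟨rfl, -, -⟩ := e3
  simp only [labels, List.map_cons, List.map_append, List.mem_cons, List.mem_append, not_or]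
    at na nb nc
  intro e _
  generalize e.label = k
  by_cases ka : a = k
  · subst ka
    have za : alt a A = 0 := alt_eq_zero (by simp only [labels]; tauto)
    have zb : alt a B = 0 := alt_eq_zero (by simp only [labels]; tauto)
    have zc : alt a C = 0 := alt_eq_zero (by simp only [labels]; tauto)
    have zd : alt a D = 0 := alt_eq_zero (by simp only [labels]; tauto)
    simp only [alt_append, alt, za, zb, zc, zd, List.length_append, List.length_cons,
      List.length_nil, hab.symm, hac.symm, if_true, if_false, pow_add]
    rw [← neg_ne_zero]
    ring_nf
  by_cases kb : b = k
  · subst kb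
    have za : alt b A = 0 := alt_eq_zero (by simp only [labels]; tauto)
    have zb : alt b B = 0 := alt_eq_zero (by simp only [labels]; tauto)
    have zc : alt b C = 0 := alt_eq_zero (by simp only [labels]; tauto)
    have zd : alt b D = 0 := alt_eq_zero (by simp only [labels]; tauto)
    simp only [alt_append, alt, za, zb, zc, zd, List.length_append, List.length_cons,
      List.length_nil, hab, hbc.symm, if_true, if_false, pow_add]
    rw [← neg_ne_zero]
    ring_nf
  by_cases kc : c = k
  · subst kc
    have za : alt c A = 0 := alt_eq_zero (by simp only [labels]; tauto)
    have zb : alt c B = 0 := alt_eq_zero (by simp only [labels]; tauto)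
    have zc : alt c C = 0 := alt_eq_zero (by simp only [labels]; tauto)
    have zd : alt c D = 0 := alt_eq_zero (by simp only [labels]; tauto)
    simp only [alt_append, alt, za, zb, zc, zd, List.length_append, List.length_cons,
      List.length_nil, hac, hbc, if_true, if_false, pow_add]
    rw [← neg_ne_zero]
    ring_nf
  · simp only [alt_append, alt, List.length_append, List.length_cons,
      List.length_nil, ka, kb, kc, if_false, pow_add]

theorem J2_relabel {L L' : List Endpoint} (h : relabelStep L L') : J2 L = J2 L' := by
  obtain ⟨f, hf, rfl⟩ := h
  have key : ∀ c (M : List Endpoint), alt (f c)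
      (M.map (fun e => Endpoint.mk (f e.label) e.isTerminal e.sign)) = alt c M := by
    intro c M
    induction M with
    | nil => rfl
    | cons x M ih => simp only [List.map_cons, alt, ih, hf.eq_iff]
  unfold J2
  rw [List.map_map]
  congr 1
  apply List.map_congr_left
  intro e _
  simp only [term, Function.comp, key, signValue]

theorem term_congr {L L' : List Endpoint} (M : List Endpoint)
    (h : ∀ k ∈ labels M, alt k L = alt k L') : (M.map (term L)).sum = (M.map (term L')).sum := by
  congr 1
  apply List.map_congr_left
  intro e he
  simp only [term, h e.label (mem_labels.2 ⟨e, he, rfl⟩)]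

theorem J2_reid1 {L L' : List Endpoint} (h : reid1 L L') : J2 L = J2 L' := by
  obtain ⟨A, B, c, t, s, hc, rfl, rfl⟩ := h
  have hp : (A ++ [Endpoint.mk c t s, Endpoint.mk c (!t) s] ++ B).Perm
      (Endpoint.mk c t s :: Endpoint.mk c (!t) s :: (A ++ B)) := by
    rw [List.append_assoc]
    exact List.perm_append_comm_assoc A [_, _] B
  unfold J2
  rw [(hp.map (term (A ++ [Endpoint.mk c t s, Endpoint.mk c (!t) s] ++ B))).sum_eq]
  simp only [List.map_cons, List.sum_cons]
  have h0 : alt c (A ++ [Endpoint.mk c t s, Endpoint.mk c (!t) s] ++ B) = 0 := by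
    simp only [labels, List.map_append, List.mem_append, not_or] at hc
    have za : alt c A = 0 := alt_eq_zero hc.1
    have zb : alt c B = 0 := alt_eq_zero hc.2
    simp [alt_append, alt, za, zb]
  have t1 : ∀ t', term (A ++ [Endpoint.mk c t s, Endpoint.mk c (!t) s] ++ B)
      (Endpoint.mk c t' s) = 0 := by
    intro t'
    simp only [term, h0, ne_eq, not_true, and_false, if_false]
  rw [t1, t1, zero_add, zero_add]
  apply term_congr
  intro k hk
  have hkc : c ≠ k := by rintro rfl; exact hc hk
  simp only [alt_append, alt, hkc, if_false, List.length_append, List.length_cons,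
    List.length_nil, pow_add]
  ring

theorem J2_reid2 {L L' : List Endpoint} (h : reid2 L L') : J2 L = J2 L' := by
  obtain ⟨A, B, C, c, d, s, cr, hcd, hc, hd, rfl, rfl⟩ := h
  have hp := reid2_perm A B C c d s cr
  unfold J2
  rw [(hp.map (term _)).sum_eq]
  set L := (A ++ [Endpoint.mk c false s, Endpoint.mk d false (!s)] ++ B ++
        (if cr then [Endpoint.mk c true s, Endpoint.mk d true (!s)]
         else [Endpoint.mk d true (!s), Endpoint.mk c true s]) ++ C) with hL
  simp only [List.map_cons, List.sum_cons]
  have h0 : alt d L = - alt c L := by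
    simp only [labels, List.map_append, List.mem_append, not_or] at hc hd
    have za : alt c A = 0 := alt_eq_zero hc.1.1
    have zb : alt c B = 0 := alt_eq_zero hc.1.2
    have zc : alt c C = 0 := alt_eq_zero hc.2
    have ya : alt d A = 0 := alt_eq_zero hd.1.1
    have yb : alt d B = 0 := alt_eq_zero hd.1.2
    have yc : alt d C = 0 := alt_eq_zero hd.2
    cases cr <;>
    simp only [hL, alt_append, alt, za, zb, zc, ya, yb, yc, hcd, hcd.symm, if_true, if_false,
      List.length_append, List.length_cons, List.length_nil, pow_add, Bool.false_eq_true] <;>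
    ring
  have t0 : term L (Endpoint.mk c false s) = 0 := by simp [term]
  have t1 : term L (Endpoint.mk d false (!s)) = 0 := by simp [term]
  have t2 : term L (Endpoint.mk d true (!s)) = - term L (Endpoint.mk c true s) := by
    simp only [term, h0, neg_ne_zero, true_and, signValue]
    cases s <;> split_ifs <;> simp_all
  rw [t0, t1, t2]
  have t3 : ((A ++ B ++ C).map (term L)).sum = ((A ++ B ++ C).map (term (A ++ B ++ C))).sum := by
    apply term_congr
    intro k hk
    have hkc : c ≠ k := by rintro rfl; exact hc hk
    have hkd : d ≠ k := by rintro rfl; exact hd hk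
    cases cr <;>
    simp only [hL, alt_append, alt, hkc, hkd, if_true, if_false, List.length_append,
      List.length_cons, List.length_nil, pow_add, Bool.false_eq_true] <;>
    ring
  rw [t3]
  ring

theorem J2_step {L L' : List Endpoint} (hL : G2 L) (h : reidStep L L' ∨ xiStep L L') :
    J2 L = J2 L' := by
  rcases h with (h | h | h | h | h) | h
  · exact J2_rotate hL h
  · exact J2_relabel h
  · exact J2_reid1 h
  · exact J2_reid2 h
  · exact J2_reid3 hL h
  · exact J2_xi h

theorem RelXi.J2_eq {L L' : List Endpoint} (h : RelXi L L') (hL : G2 L) : J2 L = J2 L' := by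
  induction h with
  | refl => rfl
  | tail h1 h ih =>
    have hb := (RelXi.G2_iff h1).1 hL
    rw [ih]
    rcases h with h | h
    · exact J2_step hb h
    · exact (J2_step ((G2_step h).2 hb) h).symm

/-! ### comparison with the chord index -/

theorem sum_value_mod (M : List Endpoint) :
    (M.map endpointValue).sum % 2 = (M.length : ℤ) % 2 := by
  induction M with
  | nil => rfl
  | cons x M ih =>
    have : endpointValue x = 1 ∨ endpointValue x = -1 := by
      simp only [endpointValue, signValue]; split_ifs <;> simp
    simp only [List.map_cons, List.sum_cons, List.length_cons]
    push_cast
    omega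

theorem neg_one_pow_cases (n : ℕ) : ((-1 : ℤ) ^ n = 1 ∧ n % 2 = 0) ∨
    ((-1 : ℤ) ^ n = -1 ∧ n % 2 = 1) := by
  rcases Nat.even_or_odd n with h | h
  · exact Or.inl ⟨h.neg_one_pow, Nat.even_iff.1 h⟩
  · exact Or.inr ⟨h.neg_one_pow, Nat.odd_iff.1 h⟩

theorem takeWhile_eq {M N : List Endpoint} {c : ℕ} {q : Endpoint} (h : c ∉ labels M)
    (hq : q.label = c) :
    (M ++ q :: N).takeWhile (fun e => e.label != c) = M := by
  rw [List.takeWhile_append_of_pos]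
  · simp [hq]
  · intro a ha
    have : a.label ≠ c := fun h' => h (mem_labels.2 ⟨a, ha, h'⟩)
    simpa using this

theorem findIdx_eq {A B : List Endpoint} {p : Endpoint} {P : Endpoint → Bool}
    (hA : ∀ a ∈ A, P a = false) (hp : P p = true) :
    (A ++ p :: B).findIdx? P = some A.length := by
  induction A with
  | nil => simp [List.findIdx?_cons, hp]
  | cons x A ih =>
    rw [List.cons_append, List.findIdx?_cons, hA x (by simp),
      ih (fun a ha => hA a (by simp [ha]))]
    simp

theorem chordIndex_alt {L : List Endpoint} (hL : G2 L) {e : Endpoint} (he : e ∈ L) :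
    chordIndex L e.label % 2 ≠ 0 ↔ alt e.label L ≠ 0 := by
  have hev := hL.even
  obtain ⟨U, hU⟩ := hL.extract he
  have hp : Endpoint.mk e.label false e.sign ∈ L := hU.symm.subset (by simp)
  generalize e.label = c at *
  generalize e.sign = s at *
  clear he
  obtain ⟨A, B, rfl⟩ := List.append_of_mem hp
  have hU' : (A ++ B).Perm (Endpoint.mk c true s :: U) := by
    have h1 := (List.perm_middle (a := Endpoint.mk c false s) (l₁ := A) (l₂ := B)).symm.trans hU
    exact h1.cons_inv
  obtain ⟨_, _, _, e1, -, hn⟩ := hL.pair hU rfl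
  simp only [Endpoint.mk.injEq] at e1
  obtain ⟨rfl, -, -⟩ := e1
  have hq : Endpoint.mk c true s ∈ A ++ B := hU'.symm.subset (by simp)
  have hA : ∀ a ∈ A, (fun e : Endpoint => e.label == c && !e.isTerminal) a = false := by
    intro a ha
    have : a ∈ Endpoint.mk c true s :: U := hU'.subset (by simp [ha])
    rcases List.mem_cons.1 this with rfl | h
    · simp
    · have : a.label ≠ c := fun h' => hn (mem_labels.2 ⟨a, h, h'⟩)
      simp [this]
  have hci : chordIndex (A ++ Endpoint.mk c false s :: B) c =
      (((B ++ A).takeWhile (fun e => e.label != c)).map endpointValue).sum := by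
    simp only [chordIndex, rotateTo]
    rw [findIdx_eq hA (by simp)]
    simp
  rw [hci, sum_value_mod]
  rcases List.mem_append.1 hq with hq | hq
  · obtain ⟨A1, A2, rfl⟩ := List.append_of_mem hq
    have hr : (A1 ++ A2 ++ B).Perm U := by
      have : (Endpoint.mk c true s :: (A1 ++ A2 ++ B)).Perm (Endpoint.mk c true s :: U) := by
        refine List.Perm.trans ?_ hU'
        rw [List.append_assoc, List.append_assoc]
        exact List.perm_middle.symm
      exact this.cons_inv
    rw [← (labels_perm hr).mem_iff] at hn
    simp only [labels, List.map_append, List.mem_append, not_or] at hn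
    obtain ⟨⟨n1, n2⟩, n3⟩ := hn
    have : B ++ (A1 ++ Endpoint.mk c true s :: A2) = (B ++ A1) ++ Endpoint.mk c true s :: A2 := by
      simp
    have hBA : c ∉ labels (B ++ A1) := by
      simp only [labels, List.map_append, List.mem_append, not_or]
      exact ⟨n3, n1⟩
    rw [this, takeWhile_eq hBA rfl]
    have z1 := alt_eq_zero n1
    have z2 := alt_eq_zero n2
    have z3 := alt_eq_zero n3
    simp only [alt_append, alt, z1, z2, z3, if_true, List.length_append, List.length_cons,
      pow_add] at *
    rw [Nat.even_iff] at hev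
    rcases neg_one_pow_cases A1.length with ⟨a1, a2⟩ | ⟨a1, a2⟩ <;>
    rcases neg_one_pow_cases A2.length with ⟨b1, b2⟩ | ⟨b1, b2⟩ <;>
    simp only [a1, b1] <;> push_cast <;> norm_num <;> omega
  · obtain ⟨B1, B2, rfl⟩ := List.append_of_mem hq
    have hr : (A ++ B1 ++ B2).Perm U := by
      have : (Endpoint.mk c true s :: (A ++ B1 ++ B2)).Perm (Endpoint.mk c true s :: U) := by
        refine List.Perm.trans ?_ hU'
        rw [← List.append_assoc]
        exact List.perm_middle.symm
      exact this.cons_inv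
    rw [← (labels_perm hr).mem_iff] at hn
    simp only [labels, List.map_append, List.mem_append, not_or] at hn
    obtain ⟨⟨n1, n2⟩, n3⟩ := hn
    rw [List.append_assoc, List.cons_append, takeWhile_eq n2 rfl]
    have z1 := alt_eq_zero n1
    have z2 := alt_eq_zero n2
    have z3 := alt_eq_zero n3
    simp only [alt_append, alt, z1, z2, z3, if_true]
    rcases neg_one_pow_cases A.length with ⟨a1, a2⟩ | ⟨a1, a2⟩ <;>
    rcases neg_one_pow_cases B1.length with ⟨b1, b2⟩ | ⟨b1, b2⟩ <;>
    simp only [a1, b1] <;> norm_num <;> omega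

theorem oddWrithe_eq_J2 {L : List Endpoint} (hL : G2 L) : oddWrithe L = J2 L := by
  unfold oddWrithe J2
  have key : ∀ M : List Endpoint, (∀ e ∈ M, e ∈ L) →
      ((M.filter (fun e => e.isTerminal && decide (chordIndex L e.label % 2 ≠ 0))).map
        signValue).sum = (M.map (term L)).sum := by
    intro M hM
    induction M with
    | nil => rfl
    | cons x M ih =>
      have hx := chordIndex_alt hL (hM x (by simp))
      have ih := ih (fun e he => hM e (by simp [he]))
      rw [List.map_cons, List.sum_cons, ← ih, List.filter_cons]
      simp only [term, hx, Bool.and_eq_true, decide_eq_true_eq]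
      by_cases h : x.isTerminal = true ∧ alt x.label L ≠ 0
      · rw [if_pos h, if_pos h]; simp
      · rw [if_neg h, if_neg h]; simp
  exact key L (fun _ h => h)

end Gauss

namespace Gauss

/-! ### Permuting endpoints within a parity class -/

theorem swap_distinct {A B : List Endpoint} {x y z : Endpoint} (h : G2 (A ++ [x, y, z] ++ B))
    (hxz : x.label ≠ z.label) : RelXi (A ++ [x, y, z] ++ B) (A ++ [z, y, x] ++ B) := by
  by_cases hxy : x.label = y.label
  · have hp : (A ++ [x, y, z] ++ B).Perm (x :: y :: (A ++ [z] ++ B)) := by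
      rw [List.perm_iff_count]
      intro a
      simp [List.count_cons] ; omega
    obtain ⟨c, t, s, rfl, rfl, hc⟩ := h.pair hp hxy
    have r1 : reid1 (A ++ [Endpoint.mk c t s, Endpoint.mk c (!t) s, z] ++ B) (A ++ [z] ++ B) :=
      ⟨A, [z] ++ B, c, t, s, by simpa using hc, by simp, by simp⟩
    have r2 : reid1 (A ++ [z, Endpoint.mk c (!t) s, Endpoint.mk c t s] ++ B) (A ++ [z] ++ B) :=
      ⟨A ++ [z], B, c, !t, s, by simpa using hc, by simp, by simp⟩
    exact (RelXi.ofReid (Or.inr (Or.inr (Or.inl r1)))).trans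
      (RelXi.ofReid (Or.inr (Or.inr (Or.inl r2)))).symm
  by_cases hyz : y.label = z.label
  · have hp : (A ++ [x, y, z] ++ B).Perm (y :: z :: (A ++ [x] ++ B)) := by
      rw [List.perm_iff_count]
      intro a
      simp [List.count_cons] ; omega
    obtain ⟨c, t, s, rfl, rfl, hc⟩ := h.pair hp hyz
    have r1 : reid1 (A ++ [x, Endpoint.mk c t s, Endpoint.mk c (!t) s] ++ B) (A ++ [x] ++ B) :=
      ⟨A ++ [x], B, c, t, s, by simpa using hc, by simp, by simp⟩
    have r2 : reid1 (A ++ [Endpoint.mk c (!t) s, Endpoint.mk c t s, x] ++ B) (A ++ [x] ++ B) :=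
      ⟨A, [x] ++ B, c, !t, s, by simpa using hc, by simp, by simp⟩
    exact (RelXi.ofReid (Or.inr (Or.inr (Or.inl r1)))).trans
      (RelXi.ofReid (Or.inr (Or.inr (Or.inl r2)))).symm
  · exact RelXi.ofXi ⟨A, B, x, y, z, hxy, hyz, hxz, rfl, rfl⟩

/-- interleaving of two words -/
def il : List Endpoint → List Endpoint → List Endpoint
  | x :: u, y :: v => x :: y :: il u v
  | _, _ => []

theorem il_perm : ∀ (u v : List Endpoint), u.length = v.length → (il u v).Perm (u ++ v)
  | [], [], _ => by simp [il]
  | x :: u, y :: v, h => by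
    have ih := il_perm u v (by simpa using h)
    simp only [il, List.cons_append]
    refine List.Perm.cons x ?_
    exact (ih.cons y).trans List.perm_middle.symm
  | [], _ :: _, h => by simp at h
  | _ :: _, [], h => by simp at h

theorem il_append : ∀ (u v u' v' : List Endpoint), u.length = v.length →
    il (u ++ u') (v ++ v') = il u v ++ il u' v'
  | [], [], _, _, _ => by simp [il]
  | x :: u, y :: v, u', v', h => by
    have ih := il_append u v u' v' (by simpa using h)
    simp only [il, List.cons_append, ih]
  | [], _ :: _, _, _, h => by simp at h
  | _ :: _, [], _, _, h => by simp at h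

theorem exists_il : ∀ (L : List Endpoint), Even L.length →
    ∃ u v, u.length = v.length ∧ L = il u v
  | [], _ => ⟨[], [], rfl, rfl⟩
  | [_], h => by simp at h
  | x :: y :: L, h => by
    obtain ⟨u, v, h1, h2⟩ := exists_il L (by
      simp only [List.length_cons, Nat.even_iff] at h ⊢; omega)
    exact ⟨x :: u, y :: v, by simp [h1], by rw [h2]; rfl⟩

/-- moving an endpoint along its parity class past endpoints with other labels -/
theorem slide (x : Endpoint) (t : List Endpoint) : ∀ (u v A : List Endpoint),
    x.label ∉ labels u → (u.length < v.length) → G2 (A ++ il (x :: u ++ t) v) →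
    RelXi (A ++ il (x :: u ++ t) v) (A ++ il (u ++ x :: t) v)
  | [], v, A, _, _, _ => RelXi.refl _
  | b :: u, [], A, _, h, _ => by simp at h
  | b :: u, [_], A, _, h, _ => by simp at h
  | b :: u, y :: y' :: v, A, hx, h, hG => by
    simp only [labels, List.map_cons, List.mem_cons, not_or] at hx
    have e1 : A ++ il (x :: b :: u ++ t) (y :: y' :: v) =
        A ++ [x, y, b] ++ (y' :: il (u ++ t) v) := by simp [il]
    have e2 : A ++ [b, y, x] ++ (y' :: il (u ++ t) v) =
        (A ++ [b, y]) ++ il (x :: u ++ t) (y' :: v) := by simp [il]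
    have e3 : A ++ il (b :: u ++ x :: t) (y :: y' :: v) =
        (A ++ [b, y]) ++ il (u ++ x :: t) (y' :: v) := by simp [il]
    rw [e1] at hG
    have s1 := swap_distinct hG hx.1
    have hG2 := s1.G2_iff.1 hG
    rw [e1, e3]
    refine s1.trans ?_
    rw [e2] at hG2 ⊢
    exact slide x t u (y' :: v) (A ++ [b, y]) hx.2 (by simpa using h) hG2

theorem il_rot (x y : Endpoint) (u v : List Endpoint) (h : u.length = v.length) :
    RelXi (il (x :: u) (y :: v)) (il (u ++ [x]) (v ++ [y])) := by
  rw [il_append u v [x] [y] h]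
  exact RelXi.rot [x, y] (il u v)

theorem exists_fresh (L : List Endpoint) : ∃ c, c ∉ labels L :=
  Infinite.exists_notMem_finset (labels L).toFinset |>.imp (fun _ h => by simpa using h)

/-- reversing a shell, with a free chord available -/
theorem shell_aux {x x' y y1 : Endpoint} {c : ℕ} {t s : Bool} {u v : List Endpoint}
    (huv : u.length = v.length)
    (hG : G2 (il (x :: x' :: Endpoint.mk c t s :: u) (y :: y1 :: Endpoint.mk c (!t) s :: v)))
    (hx : x.label = x'.label) :
    RelXi (il (x :: x' :: Endpoint.mk c t s :: u) (y :: y1 :: Endpoint.mk c (!t) s :: v))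
      (il (x' :: x :: Endpoint.mk c t s :: u) (y :: y1 :: Endpoint.mk c (!t) s :: v)) := by
  set b := Endpoint.mk c t s with hb
  set V := (y1 :: Endpoint.mk c (!t) s :: v) with hV
  have hVl : V.length = u.length + 2 := by simp [hV, huv]
  have hp := il_perm (x :: x' :: b :: u) (y :: V) (by simp [hVl])
  have hG0 := hG.perm hp
  have pb : (x :: x' :: b :: u ++ y :: V).Perm (b :: Endpoint.mk c (!t) s ::
      (x :: x' :: u ++ y :: y1 :: v)) := by
    rw [List.perm_iff_count]
    intro a
    simp [List.count_cons, hV] ; omega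
  obtain ⟨_, _, _, e1, -, nb⟩ := hG0.pair pb rfl
  simp only [hb, Endpoint.mk.injEq] at e1
  obtain ⟨rfl, -, -⟩ := e1
  have px : (x :: x' :: b :: u ++ y :: V).Perm (x :: x' :: (b :: u ++ y :: V)) := by
    simp
  obtain ⟨d, t', s', ex, ex', nx⟩ := hG0.pair px hx
  have hxd : x.label = d := by rw [ex]
  have hxd' : x'.label = d := by rw [ex']
  simp only [labels, List.map_cons, List.map_append, List.cons_append, List.mem_cons,
    List.mem_append, not_or] at nb nx
  have hbl : b.label = c := rfl
  -- step 1: (b x x' u) to (x x' b u)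
  have q1 : (il (x :: x' :: b :: u) (y :: V)).Perm (il (b :: x :: x' :: u) (y :: V)) := by
    refine hp.trans (List.Perm.trans ?_ (il_perm (b :: x :: x' :: u) (y :: V)
      (by simp [hVl])).symm)
    rw [List.perm_iff_count]
    intro a
    simp [List.count_cons]; omega
  have hG1 := hG.perm q1
  have s1 : RelXi (il (b :: x :: x' :: u) (y :: V)) (il (x :: x' :: b :: u) (y :: V)) := by
    have := slide b u [x, x'] (y :: V) [] (by simp [labels, hbl]; tauto) (by simp [hVl])
      (by simpa using hG1)
    simpa using this
  -- step 2: (b x x' u) to (b x u x')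
  have s2 : RelXi (il (b :: x :: x' :: u) (y :: V)) (il (b :: x :: u ++ [x']) (y :: V)) := by
    have := slide x' [] u (Endpoint.mk c (!t) s :: v) [b, y, x, y1]
      (by simp only [labels]; rw [hxd']; tauto) (by simp [huv])
      (by simpa [il, hV] using hG1)
    simpa [il, hV] using this
  have hG2 := s2.G2_iff.1 hG1
  -- step 3: exchange b and x' across the base point
  have s3 : RelXi (il (b :: x :: u ++ [x']) (y :: V)) (il (x' :: x :: u ++ [b]) (y :: V)) := by
    have r1 := il_rot b y (x :: u ++ [x']) V (by simp [hVl])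
    have r2 := il_rot x' y (x :: u ++ [b]) V (by simp [hVl])
    have hG3 := r1.G2_iff.1 hG2
    refine RelXi.trans r1 (RelXi.trans ?_ r2.symm)
    obtain ⟨V', z, hV'⟩ : ∃ V' z, V = V' ++ [z] :=
      ⟨V.dropLast, V.getLast (by simp [hV]), (List.dropLast_append_getLast _).symm⟩
    have hl : (x :: u).length = V'.length := by
      rw [hV'] at hVl; simp at hVl ⊢; omega
    have i1 : il (x :: u ++ [x'] ++ [b]) (V ++ [y]) = il (x :: u) V' ++ [x', z, b] ++ [y] := by
      rw [hV', List.append_assoc, List.append_assoc, il_append _ _ _ _ hl]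
      simp [il]
    have i2 : il (x :: u ++ [b] ++ [x']) (V ++ [y]) = il (x :: u) V' ++ [b, z, x'] ++ [y] := by
      rw [hV', List.append_assoc, List.append_assoc, il_append _ _ _ _ hl]
      simp [il]
    rw [i1] at hG3 ⊢
    rw [i2]
    exact swap_distinct hG3 (by rw [hxd', hbl]; tauto)
  -- step 4: move b back
  have hG4 := s3.G2_iff.1 hG2
  have q4 : (il (x' :: x :: u ++ [b]) (y :: V)).Perm (il (x' :: x :: b :: u) (y :: V)) := by
    refine (il_perm _ _ (by simp [hVl])).trans (List.Perm.trans ?_ (il_perm _ _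
      (by simp [hVl])).symm)
    rw [List.perm_iff_count]
    intro a
    simp [List.count_cons]; omega
  have s4 : RelXi (il (x' :: x :: b :: u) (y :: V)) (il (x' :: x :: u ++ [b]) (y :: V)) := by
    have := slide b [] u (Endpoint.mk c (!t) s :: v) [x', y, x, y1]
      (by simp only [labels]; rw [hbl]; tauto) (by simp [huv])
      (by simpa [il, hV] using hG4.perm q4)
    simpa [il, hV] using this
  exact s1.symm.trans (s2.trans (s3.trans s4.symm))

theorem shell {x x' y y1 : Endpoint} {u v : List Endpoint} (huv : u.length = v.length)
    (hG : G2 (il (x :: x' :: u) (y :: y1 :: v))) (hx : x.label = x'.label) :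
    RelXi (il (x :: x' :: u) (y :: y1 :: v)) (il (x' :: x :: u) (y :: y1 :: v)) := by
  obtain ⟨c, hc⟩ := exists_fresh (il (x :: x' :: u) (y :: y1 :: v))
  have hc' : c ∉ labels (il (x' :: x :: u) (y :: y1 :: v)) := by
    simp only [il, labels, List.map_cons, List.mem_cons, not_or] at hc ⊢
    tauto
  have r1 : reid1 (il (x :: x' :: Endpoint.mk c false true :: u)
      (y :: y1 :: Endpoint.mk c (!false) true :: v)) (il (x :: x' :: u) (y :: y1 :: v)) :=
    ⟨[x, y, x', y1], il u v, c, false, true, by simpa [il] using hc, by simp [il], by simp [il]⟩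
  have r2 : reid1 (il (x' :: x :: Endpoint.mk c false true :: u)
      (y :: y1 :: Endpoint.mk c (!false) true :: v)) (il (x' :: x :: u) (y :: y1 :: v)) :=
    ⟨[x', y, x, y1], il u v, c, false, true, by simpa [il] using hc', by simp [il], by simp [il]⟩
  have R1 := RelXi.ofReid (Or.inr (Or.inr (Or.inl r1)))
  have R2 := RelXi.ofReid (Or.inr (Or.inr (Or.inl r2)))
  exact R1.symm.trans ((shell_aux huv (R1.G2_iff.2 hG) hx).trans R2)

theorem swap {A B : List Endpoint} {x y z : Endpoint} (h : G2 (A ++ [x, y, z] ++ B)) :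
    RelXi (A ++ [x, y, z] ++ B) (A ++ [z, y, x] ++ B) := by
  by_cases hxz : x.label = z.label
  swap
  · exact swap_distinct h hxz
  have r1 : RelXi (A ++ [x, y, z] ++ B) ([x, y, z] ++ (B ++ A)) := by
    have := RelXi.rot A ([x, y, z] ++ B)
    simpa using this
  have r2 : RelXi (A ++ [z, y, x] ++ B) ([z, y, x] ++ (B ++ A)) := by
    have := RelXi.rot A ([z, y, x] ++ B)
    simpa using this
  have hG := r1.G2_iff.1 h
  refine r1.trans (RelXi.trans ?_ r2.symm)
  have hev := hG.even
  generalize B ++ A = D at *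
  cases D with
  | nil => simp at hev; exact absurd hev (by decide)
  | cons w D =>
    obtain ⟨u, v, huv, rfl⟩ := exists_il D (by
      simp only [List.length_append, List.length_cons, List.length_nil, Nat.even_iff] at hev ⊢
      omega)
    exact shell (y := y) (y1 := w) huv hG hxz

theorem perm_left {u u' : List Endpoint} (h : u.Perm u') : ∀ (v A : List Endpoint),
    u.length = v.length → G2 (A ++ il u v) → RelXi (A ++ il u v) (A ++ il u' v) := by
  induction h with
  | nil => intro v A _ _; exact RelXi.refl _
  | cons x h ih =>
    intro v A hl hG
    cases v with
    | nil => simp at hl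
    | cons y v =>
      have := ih v (A ++ [x, y]) (by simpa using hl) (by simpa [il] using hG)
      simpa [il] using this
  | swap x y l =>
    intro v A hl hG
    match v, hl, hG with
    | [], hl, _ => simp at hl
    | [_], hl, _ => simp at hl
    | a :: b :: v, hl, hG =>
      have := swap (A := A) (B := b :: il l v) (x := y) (y := a) (z := x)
        (by simpa [il] using hG)
      simpa [il] using this
  | trans h1 h2 ih1 ih2 =>
    intro v A hl hG
    have s1 := ih1 v A hl hG
    exact s1.trans (ih2 v A (h1.length_eq ▸ hl) (s1.G2_iff.1 hG))

theorem perm_right {v v' : List Endpoint} (h : v.Perm v') : ∀ (u A : List Endpoint),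
    u.length = v.length → G2 (A ++ il u v) → RelXi (A ++ il u v) (A ++ il u v') := by
  induction h with
  | nil => intro v A _ _; exact RelXi.refl _
  | cons x h ih =>
    intro u A hl hG
    cases u with
    | nil => simp at hl
    | cons y u =>
      have := ih u (A ++ [y, x]) (by simpa using hl) (by simpa [il] using hG)
      simpa [il] using this
  | swap x y l =>
    intro u A hl hG
    match u, hl, hG with
    | [], hl, _ => simp at hl
    | [_], hl, _ => simp at hl
    | a :: b :: u, hl, hG =>
      have := swap (A := A ++ [a]) (B := il u l) (x := y) (y := b) (z := x)
        (by simpa [il] using hG)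
      simpa [il] using this
  | trans h1 h2 ih1 ih2 =>
    intro u A hl hG
    have s1 := ih1 u A hl hG
    exact s1.trans (ih2 u A (h1.length_eq ▸ hl) (s1.G2_iff.1 hG))

theorem perm_both {u u' v v' : List Endpoint} (hu : u.Perm u') (hv : v.Perm v')
    (hl : u.length = v.length) (hG : G2 (il u v)) : RelXi (il u v) (il u' v') := by
  have s1 := perm_left hu v [] hl hG
  exact s1.trans (perm_right hv u' [] (hu.length_eq ▸ hl) (s1.G2_iff.1 hG))

/-! ### Standard words -/

def dbl (s : Bool) (E : List ℕ) : List Endpoint :=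
  E.flatMap (fun c => [Endpoint.mk c false s, Endpoint.mk c true s])

theorem dbl_length (s : Bool) (E : List ℕ) : (dbl s E).length = 2 * E.length := by
  induction E with
  | nil => rfl
  | cons c E ih => simp only [dbl, List.flatMap_cons, List.length_append] at *; simp [ih]; omega

theorem mem_dbl {s : Bool} {E : List ℕ} {c : ℕ} : c ∈ labels (dbl s E) ↔ c ∈ E := by
  induction E with
  | nil => simp [labels, dbl]
  | cons d E ih =>
    simp only [labels, dbl, List.flatMap_cons, List.map_append, List.mem_append] at ih ⊢
    simp [ih]

theorem G2.exists_dbl {s : Bool} {U : List Endpoint} (hU : G2 U) (hs : ∀ x ∈ U, x.sign = s) :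
    ∃ E : List ℕ, E.Nodup ∧ U.Perm (dbl s E) := by
  induction hn : U.length using Nat.strong_induction_on generalizing U with
  | _ n ih =>
    cases U with
    | nil => exact ⟨[], by simp, by simp [dbl]⟩
    | cons x L =>
      obtain ⟨U, hp⟩ := hU.extract (List.mem_cons_self (a := x) (l := L))
      have h1 := hp.length_eq
      have h2 := hU.tail (t := false) hp
      rw [hs x (by simp)] at hp
      obtain ⟨_, _, _, e1, -, hn'⟩ := hU.pair hp rfl
      simp only [Endpoint.mk.injEq] at e1
      obtain ⟨rfl, -, -⟩ := e1
      simp only [List.length_cons] at h1 hn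
      obtain ⟨E, hE, hUE⟩ := ih U.length (by omega) h2
        (fun y hy => hs y (hp.symm.subset (by simp [hy]))) rfl
      refine ⟨x.label :: E, ?_, ?_⟩
      · rw [(labels_perm hUE).mem_iff, mem_dbl] at hn'
        exact List.nodup_cons.2 ⟨hn', hE⟩
      · refine hp.trans ?_
        simp only [dbl, List.flatMap_cons, List.cons_append, List.nil_append]
        exact (hUE.cons _).cons _

def Std (s : Bool) (E O : List ℕ) : List Endpoint := il (dbl s E) (dbl s O)

theorem reduce : ∀ (n : ℕ) (U V : List Endpoint), U.length = n → V.length = n → G2 (il U V) →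
    ∃ s E O, E.length = O.length ∧ (E ++ O).Nodup ∧ RelXi (il U V) (Std s E O) := by
  intro n
  induction n using Nat.strong_induction_on with
  | _ n ih =>
  intro U V hU hV hG
  have hUV : U.length = V.length := hU.trans hV.symm
  have hGp := hG.perm (il_perm U V hUV)
  by_cases c1 : ∃ e ∈ U, ∃ e' ∈ V, e.label = e'.label
  · obtain ⟨e, he, e', he', hl⟩ := c1
    have pU := List.perm_cons_erase he
    have pV := List.perm_cons_erase he'
    have s1 := perm_both pU pV hUV hG
    have hG1 := s1.G2_iff.1 hG
    have hlU := pU.length_eq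
    have hlV := pV.length_eq
    generalize U.erase e = U' at *
    generalize V.erase e' = V' at *
    simp only [il] at s1 hG1
    obtain ⟨c, t, s, rfl, rfl, hc⟩ := hG1.pair (List.Perm.refl _) hl
    have r1 : reid1 (Endpoint.mk c t s :: Endpoint.mk c (!t) s :: il U' V') (il U' V') :=
      ⟨[], il U' V', c, t, s, by simpa using hc, by simp, by simp⟩
    have R1 := s1.trans (RelXi.ofReid (Or.inr (Or.inr (Or.inl r1))))
    simp only [List.length_cons] at hlU hlV
    obtain ⟨s, E, O, h1, h2, h3⟩ := ih U'.length (by omega) U' V' rfl (by omega)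
      (R1.G2_iff.1 hG)
    exact ⟨s, E, O, h1, h2, R1.trans h3⟩
  have hdis : ∀ c, c ∈ labels U → c ∉ labels V := by
    intro c h1 h2
    obtain ⟨x, hx, rfl⟩ := mem_labels.1 h1
    obtain ⟨y, hy, hxy⟩ := mem_labels.1 h2
    exact c1 ⟨x, hx, y, hy, hxy.symm⟩
  have gU : G2 U := by
    intro c
    by_cases hc : c ∈ labels U
    · have := hGp c
      rwa [fl_append, fl_eq_nil.2 (hdis c hc), List.append_nil] at this
    · exact Or.inl (fl_eq_nil.2 hc)
  have gV : G2 V := by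
    intro c
    by_cases hc : c ∈ labels V
    · have := hGp c
      rwa [fl_append, fl_eq_nil.2 (fun h => hdis c h hc), List.nil_append] at this
    · exact Or.inl (fl_eq_nil.2 hc)
  by_cases c2 : ∃ x ∈ U, ∃ y ∈ V, y.sign = !x.sign
  · obtain ⟨x, hx, y, hy, hs⟩ := c2
    obtain ⟨U', pU⟩ := gU.extract hx
    obtain ⟨V', pV⟩ := gV.extract hy
    rw [hs] at pV
    have hxy : x.label ≠ y.label := fun h => c1 ⟨x, hx, y, hy, h⟩
    have s1 := perm_both pU pV hUV hG
    have hlU := pU.length_eq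
    have hlV := pV.length_eq
    simp only [List.length_cons] at hlU hlV
    have hl' : U'.length = V'.length := by omega
    have nx : x.label ∉ labels U' ∧ x.label ∉ labels V' := by
      constructor
      · obtain ⟨_, _, _, e1, -, h⟩ := gU.pair pU rfl
        simp only [Endpoint.mk.injEq] at e1
        obtain ⟨rfl, -, -⟩ := e1
        exact h
      · intro h
        refine hdis x.label (mem_labels.2 ⟨x, hx, rfl⟩) ((labels_perm pV).mem_iff.2 ?_)
        simp only [labels, List.map_cons, List.mem_cons] at h ⊢
        tauto
    have ny : y.label ∉ labels U' ∧ y.label ∉ labels V' := by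
      constructor
      · intro h
        refine hdis y.label ((labels_perm pU).mem_iff.2 ?_) (mem_labels.2 ⟨y, hy, rfl⟩)
        simp only [labels, List.map_cons, List.mem_cons] at h ⊢
        tauto
      · obtain ⟨_, _, _, e1, -, h⟩ := gV.pair pV rfl
        simp only [Endpoint.mk.injEq] at e1
        obtain ⟨rfl, -, -⟩ := e1
        exact h
    have pl := labels_perm (il_perm U' V' hl')
    have fx : x.label ∉ labels (il U' V') := by
      rw [pl.mem_iff]
      simp only [labels, List.map_append, List.mem_append, not_or] at nx ⊢
      exact nx
    have fy : y.label ∉ labels (il U' V') := by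
      rw [pl.mem_iff]
      simp only [labels, List.map_append, List.mem_append, not_or] at ny ⊢
      exact ny
    have r1 : reid2 (il (Endpoint.mk x.label false x.sign :: Endpoint.mk x.label true x.sign :: U')
        (Endpoint.mk y.label false (!x.sign) :: Endpoint.mk y.label true (!x.sign) :: V'))
        (il U' V') :=
      ⟨[], [], il U' V', x.label, y.label, x.sign, true, hxy, by simpa using fx,
        by simpa using fy, by simp [il], by simp⟩
    have R1 := s1.trans (RelXi.ofReid (Or.inr (Or.inr (Or.inr (Or.inl r1)))))
    obtain ⟨s, E, O, h1, h2, h3⟩ := ih U'.length (by omega) U' V' rfl (by omega)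
      (R1.G2_iff.1 hG)
    exact ⟨s, E, O, h1, h2, R1.trans h3⟩
  have c2' : ∀ x ∈ U, ∀ y ∈ V, y.sign = x.sign := by
    intro x hx y hy
    by_contra h
    exact c2 ⟨x, hx, y, hy, by cases hx' : x.sign <;> cases hy' : y.sign <;> simp_all⟩
  obtain ⟨s, hs1, hs2⟩ : ∃ s, (∀ x ∈ U, x.sign = s) ∧ (∀ x ∈ V, x.sign = s) := by
    cases U with
    | nil =>
      have : V = [] := by
        rw [← List.length_eq_zero_iff, ← hUV]; rfl
      subst this
      exact ⟨true, by simp, by simp⟩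
    | cons x U =>
      cases V with
      | nil => simp at hUV
      | cons y V =>
        refine ⟨y.sign, fun z hz => (c2' z hz y (by simp)).symm, fun z hz => ?_⟩
        rw [c2' x (by simp) z hz, c2' x (by simp) y (by simp)]
  obtain ⟨E, hE, pE⟩ := gU.exists_dbl hs1
  obtain ⟨O, hO, pO⟩ := gV.exists_dbl hs2
  refine ⟨s, E, O, ?_, ?_, perm_both pE pO hUV hG⟩
  · have h1 := pE.length_eq
    have h2 := pO.length_eq
    rw [dbl_length] at h1 h2
    omega
  · rw [List.nodup_append]
    refine ⟨hE, hO, ?_⟩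
    rintro a ha b hb rfl
    rw [← mem_dbl (s := s)] at ha hb
    exact hdis a ((labels_perm pE).mem_iff.2 ha) ((labels_perm pO).mem_iff.2 hb)

theorem alt_il (c : ℕ) : ∀ (u v : List Endpoint), u.length = v.length →
    alt c (il u v) = ((labels u).count c : ℤ) - (labels v).count c
  | [], [], _ => by simp [il, alt, labels]
  | x :: u, y :: v, h => by
    have ih := alt_il c u v (by simpa using h)
    simp only [labels] at ih
    simp only [il, alt, ih, labels, List.map_cons, List.count_cons, beq_iff_eq]
    push_cast
    ring
  | [], _ :: _, h => by simp at h
  | _ :: _, [], h => by simp at h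

theorem sum_dbl (s : Bool) (L : List Endpoint) (E : List ℕ) (h : ∀ c ∈ E, alt c L ≠ 0) :
    ((dbl s E).map (term L)).sum = (if s then 1 else -1) * (E.length : ℤ) := by
  induction E with
  | nil => simp [dbl]
  | cons c E ih =>
    have ih := ih (fun d hd => h d (by simp [hd]))
    have hc := h c (by simp)
    simp only [dbl, List.flatMap_cons, List.map_append, List.sum_append] at ih ⊢
    rw [ih]
    simp only [List.map_cons, List.map_nil, List.sum_cons, List.sum_nil, term, signValue, hc,
      ne_eq, not_false_eq_true, and_true, if_true, List.length_cons, Bool.false_eq_true, if_false]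
    push_cast
    ring

theorem J2_Std (s : Bool) (E O : List ℕ) (hl : E.length = O.length) (hn : (E ++ O).Nodup) :
    J2 (Std s E O) = (if s then 1 else -1) * (2 * (E.length : ℤ)) := by
  have hlen : (dbl s E).length = (dbl s O).length := by simp [dbl_length, hl]
  rw [List.nodup_append] at hn
  unfold J2
  have hp : (Std s E O).Perm (dbl s E ++ dbl s O) := il_perm _ _ hlen
  rw [(hp.map (term (Std s E O))).sum_eq, List.map_append, List.sum_append,
    sum_dbl, sum_dbl, ← hl]
  · ring
  · intro c hc
    rw [Std, alt_il c _ _ hlen]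
    have h1 : (labels (dbl s E)).count c = 0 :=
      List.count_eq_zero.2 (fun h => hn.2.2 c (mem_dbl.1 h) c hc rfl)
    have h2 : 0 < (labels (dbl s O)).count c := List.count_pos_iff.2 (mem_dbl.2 hc)
    rw [h1]
    push_cast
    omega
  · intro c hc
    rw [Std, alt_il c _ _ hlen]
    have h1 : (labels (dbl s O)).count c = 0 :=
      List.count_eq_zero.2 (fun h => hn.2.2 c hc c (mem_dbl.1 h) rfl)
    have h2 : 0 < (labels (dbl s E)).count c := List.count_pos_iff.2 (mem_dbl.2 hc)
    rw [h1]
    push_cast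
    omega

/-- an injective relabeling carrying one duplicate-free list to another -/
theorem exists_inj (l l' : List ℕ) (h : l.Nodup) (h' : l'.Nodup) (hl : l.length = l'.length) :
    ∃ f : ℕ → ℕ, Function.Injective f ∧ l.map f = l' := by
  have hb : ∀ k ∈ l', k ≤ l'.sum := fun k hk => List.single_le_sum (by simp) k hk
  have hidx : ∀ x ∈ l, l.idxOf x < l'.length := fun x hx => hl ▸ List.idxOf_lt_length_of_mem hx
  refine ⟨fun x => if hx : x ∈ l then l'[l.idxOf x]'(hidx x hx) else x + l'.sum + 1, ?_, ?_⟩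
  · intro a b hab
    simp only at hab
    split_ifs at hab with h1 h2 h2
    · have := (List.Nodup.getElem_inj_iff h').1 hab
      exact (List.idxOf_inj h1).1 this
    · have := hb _ (List.getElem_mem (hidx a h1))
      omega
    · have := hb _ (List.getElem_mem (hidx b h2))
      omega
    · omega
  · apply List.ext_getElem
    · simpa using hl
    · intro i h1 h2
      have h3 : i < l.length := by simpa using h1
      simp [List.getElem_map, h.idxOf_getElem i h3]

theorem map_il (g : Endpoint → Endpoint) : ∀ u v : List Endpoint,
    (il u v).map g = il (u.map g) (v.map g)
  | [], v => by simp [il]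
  | _ :: _, [] => by simp [il]
  | x :: u, y :: v => by simp [il, map_il g u v]

theorem Std_relabel (s : Bool) (E O E' O' : List ℕ) (hl : E.length = O.length)
    (hl' : E'.length = O'.length) (he : E.length = E'.length) (hn : (E ++ O).Nodup)
    (hn' : (E' ++ O').Nodup) : RelXi (Std s E O) (Std s E' O') := by
  obtain ⟨f, hf, hm⟩ := exists_inj _ _ hn hn' (by simp; omega)
  rw [List.map_append] at hm
  obtain ⟨rfl, rfl⟩ := List.append_inj hm (by simpa using he)
  refine RelXi.ofReid (Or.inr (Or.inl ⟨f, hf, ?_⟩))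
  have key : ∀ E : List ℕ, (dbl s E).map
      (fun e => Endpoint.mk (f e.label) e.isTerminal e.sign) = dbl s (E.map f) := by
    intro E
    induction E with
    | nil => rfl
    | cons c E ih => simp only [dbl, List.flatMap_cons, List.map_append, List.map_cons] at *; simp [ih]
  rw [Std, Std, map_il, key, key]

theorem main (G G' : List Endpoint) (hG : G2 G) (hG' : G2 G') : J2 G = J2 G' ↔ RelXi G G' := by
  constructor
  · intro h
    obtain ⟨U, V, hl, rfl⟩ := exists_il G hG.even
    obtain ⟨U', V', hl', rfl⟩ := exists_il G' hG'.even
    obtain ⟨s, E, O, h1, h2, h3⟩ := reduce _ U V rfl hl.symm hG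
    obtain ⟨s', E', O', h1', h2', h3'⟩ := reduce _ U' V' rfl hl'.symm hG'
    rw [h3.J2_eq hG, h3'.J2_eq hG', J2_Std _ _ _ h1 h2, J2_Std _ _ _ h1' h2'] at h
    refine h3.trans (RelXi.trans ?_ h3'.symm)
    have hlen : E.length = E'.length := by
      cases s <;> cases s' <;> simp at h <;> omega
    by_cases hs : s = s'
    · subst hs
      exact Std_relabel s E O E' O' h1 h1' hlen h2 h2'
    · have : E.length = 0 := by
        cases s <;> cases s' <;> simp at h hs <;> omega
      have e1 := List.length_eq_zero_iff.1 this
      have e2 := List.length_eq_zero_iff.1 (hlen ▸ this)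
      subst e1 e2
      exact RelXi.refl _
  · exact fun h => h.J2_eq hG

end Gauss

open Gauss in
/-- Satoh–Taniguchi: two virtual knots have the same odd writhe
iff they are related by a finite sequence of Ξ-moves (and Reidemeister moves). -/
theorem oddWrithe_eq_iff_relXi
    (G G' : List Endpoint) (hG : IsGaussDiagram G) (hG' : IsGaussDiagram G') :
    oddWrithe G = oddWrithe G' ↔ RelXi G G' := by
  rw [oddWrithe_eq_J2 ((G2_iff G).1 hG), oddWrithe_eq_J2 ((G2_iff G').1 hG')]
  exact main G G' ((G2_iff G).1 hG) ((G2_iff G').1 hG')
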